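/- For all k, m ≥ 1: every symbol of the Hart–Sharir sequence S_k(m) whose rank is at least 2 is left-clamped in S_k(m), and every symbol of S_k(m) other than the very last symbol of S_k(m) is right-clamped in S_k(m). -/

import Mathlib

/-! ### Sequences with special blocks, encoded as token lists

A sequence with special blocks is encoded as a list of tokens: `Tok.sym a` is an
occurrence of the symbol `a`, and `Tok.op` / `Tok.cl` are the opening and closing
parentheses delimiting the special blocks. -/

/-- Tokens of a symbol sequence with special blocks. -/
inductive Tok : Type where
  | sym : ℕ → Tok
  | op : Tok
  | cl : Tok
deriving DecidableEq, Repr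

/-- Tokens of an endpoint sequence with special blocks: `L a` / `R a` are the
left/right endpoint letters of the symbol `a`, and `op`/`cl` delimit blocks. -/
inductive ETok : Type where
  | L : ℕ → ETok
  | R : ℕ → ETok
  | op : ETok
  | cl : ETok
deriving DecidableEq, Repr

/-- Fresh relabeling of the symbols of the `i`-th local copy. -/
def loc (i a : ℕ) : ℕ := 2 * Nat.pair i a

/-- Relabeling of the global symbols. -/
def glob (a : ℕ) : ℕ := 2 * a + 1

/-- The underlying sequence of symbols of a token list (parentheses dropped). -/
def symsOf : List Tok → List ℕ
  | [] => []
  | Tok.sym a :: r => a :: symsOf r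
  | _ :: r => symsOf r

/-- Read a special block: the symbols up to (and excluding) the next closing
parenthesis, together with the remainder of the list after that parenthesis. -/
def takeBlock : List Tok → List ℕ × List Tok
  | [] => ([], [])
  | Tok.cl :: r => ([], r)
  | Tok.sym a :: r => ((takeBlock r).1.cons a, (takeBlock r).2)
  | Tok.op :: r => takeBlock r

theorem takeBlock_len : ∀ l : List Tok, (takeBlock l).2.length ≤ l.length := by
  intro l
  induction l with
  | nil => simp [takeBlock]
  | cons t r ih => cases t <;> simp [takeBlock] <;> omega

/-- Auxiliary function for the shuffle `A • B`: traverse the `i`-th fresh copy of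
`A` (relabeling its symbols by `loc i`), inserting the next global symbol of the
list `ins` (relabeled by `glob`) at the end of each special block and duplicating
the previously last symbol of that block immediately after the block.  The third
argument remembers the (relabeled) last symbol seen. -/
def copyIns (i : ℕ) : List Tok → List ℕ → Option ℕ → List Tok
  | [], _, _ => []
  | Tok.sym a :: r, ins, _ => Tok.sym (loc i a) :: copyIns i r ins (some (loc i a))
  | Tok.op :: r, ins, p => Tok.op :: copyIns i r ins p
  | Tok.cl :: r, b :: ins, some q =>
      Tok.sym (glob b) :: Tok.cl :: Tok.sym q :: copyIns i r ins (some q)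
  | Tok.cl :: r, ins, p => Tok.cl :: copyIns i r ins p

/-- The modified copy `Aᵢ'` of `A` used in the shuffle `A • B`: the symbols of the
`i`-th special block `blk` of `B` are inserted into the special blocks of the copy,
and another copy of the last symbol of `blk` is appended at the very end. -/
def copyA (i : ℕ) (A : List Tok) (blk : List ℕ) : List Tok :=
  copyIns i A blk none ++ (blk.getLast?.elim [] fun a => [Tok.sym (glob a)])

/-- Auxiliary function for the shuffle: traverse `B` (relabeling its symbols by
`glob`), replacing its `i`-th special block by the modified `i`-th copy of `A`. -/
def bulletAux (A : List Tok) : ℕ → List Tok → List Tok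
  | _, [] => []
  | i, Tok.op :: r => copyA i A (takeBlock r).1 ++ bulletAux A (i + 1) (takeBlock r).2
  | i, Tok.sym a :: r => Tok.sym (glob a) :: bulletAux A i r
  | i, Tok.cl :: r => Tok.cl :: bulletAux A i r
termination_by _ l => l.length
decreasing_by
  · exact Nat.lt_succ_of_le (takeBlock_len r)
  · exact Nat.lt_succ_self _
  · exact Nat.lt_succ_self _

/-- The shuffle `A • B` of two sequences with special blocks. -/
def bullet (A B : List Tok) : List Tok := bulletAux A 0 B

/-- Split each special block of length 2 into two special blocks of length 1. -/
def split2 : List Tok → List Tok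
  | Tok.op :: Tok.sym a :: Tok.sym b :: Tok.cl :: r =>
      Tok.op :: Tok.sym a :: Tok.cl :: Tok.op :: Tok.sym b :: Tok.cl :: split2 r
  | t :: r => t :: split2 r
  | [] => []

/-- The Hart–Sharir sequence `S₁(m) = (1 2 ⋯ m) (m−1) ⋯ 2 1 2 ⋯ m`,
with a single special block `(1 2 ⋯ m)`. -/
def S1 (m : ℕ) : List Tok :=
  Tok.op :: ((List.range' 1 m).map Tok.sym) ++ Tok.cl ::
    (((List.range' 1 (m - 1)).reverse.map Tok.sym) ++ ((List.range' 2 (m - 1)).map Tok.sym))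

/-- The number of special blocks of a token sequence. -/
def numBlocks (S : List Tok) : ℕ := S.count Tok.op

/-- The Hart–Sharir sequences `S_k(m)`, defined by double recursion:
`S₁(m)` is the `N`-shaped sequence above; for `k ≥ 2`, `S_k(1)` is `S_{k−1}(2)` with
each special block of length 2 split into two special blocks of length 1; and for
`k, m ≥ 2`, `S_k(m) = S_k(m−1) • S_{k−1}(N)` where `N` is the number of special
blocks of `S_k(m−1)`.  (The value for `k = 0` or `m = 0` is junk.) -/
def HS : ℕ → ℕ → List Tok
  | 0, _ => []
  | 1, m => S1 m
  | _ + 2, 0 => []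
  | k + 2, 1 => split2 (HS (k + 1) 2)
  | k + 2, m + 2 => bullet (HS (k + 2) (m + 1)) (HS (k + 1) (numBlocks (HS (k + 2) (m + 1))))
termination_by k m => (k, m)



/-- The list of special blocks of a token sequence (each block as its list of symbols). -/
def blocksOf : List Tok → List (List ℕ)
  | [] => []
  | Tok.op :: r => (takeBlock r).1 :: blocksOf (takeBlock r).2
  | _ :: r => blocksOf r
termination_by l => l.length
decreasing_by
  · exact Nat.lt_succ_of_le (takeBlock_len r)
  · exact Nat.lt_succ_self _

/-- The rank of a symbol: the position (counting from 1) that its first occurrence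
occupies within its special block (`0` if the symbol lies in no special block). -/
def rankOf (S : List Tok) (a : ℕ) : ℕ :=
  match (blocksOf S).find? (fun b => decide (a ∈ b)) with
  | some b => b.idxOf a + 1
  | none => 0

/-- Two symbols have their first occurrences in the same special block. -/
def SameBlock (S : List Tok) (a b : ℕ) : Prop :=
  ∃ blk ∈ blocksOf S, a ∈ blk ∧ b ∈ blk

/-- The symbol `a` is left-clamped in the sequence `s`: `s` contains the
subsequence `b a b a`, where `b` is the symbol immediately preceding the first
occurrence of `a` in `s`. -/
def LeftClamped (s : List ℕ) (a : ℕ) : Prop :=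
  ∃ (u v : List ℕ) (b : ℕ), s = u ++ b :: a :: v ∧ a ∉ u ∧ b ≠ a ∧
    [b, a, b, a].Sublist s

/-- The symbol `a` is right-clamped in the sequence `s`: `s` contains the
subsequence `a b a b`, where `b` is the symbol immediately following the last
occurrence of `a` in `s`. -/
def RightClamped (s : List ℕ) (a : ℕ) : Prop :=
  ∃ (u v : List ℕ) (b : ℕ), s = u ++ a :: b :: v ∧ a ∉ v ∧ b ≠ a ∧
    [a, b, a, b].Sublist s

/-- Auxiliary function for the endpoint sequence: the first argument collects the
symbols already seen.  The first occurrence of each symbol becomes an `L` letter,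
its last occurrence becomes an `R` letter, all other occurrences are deleted, and
parentheses are kept. -/
def EAux : List ℕ → List Tok → List ETok
  | _, [] => []
  | seen, Tok.op :: r => ETok.op :: EAux seen r
  | seen, Tok.cl :: r => ETok.cl :: EAux seen r
  | seen, Tok.sym a :: r =>
      if a ∈ seen then
        if a ∈ symsOf r then EAux seen r else ETok.R a :: EAux seen r
      else ETok.L a :: EAux (a :: seen) r

/-- The endpoint sequence `E(S)` of a sequence with special blocks. -/
def Efun (S : List Tok) : List ETok := EAux [] S

/-- Read a special block of an endpoint sequence: the labels of the `L` letters up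
to the next closing parenthesis, and the remainder of the list after it. -/
def takeBlockE : List ETok → List ℕ × List ETok
  | [] => ([], [])
  | ETok.cl :: r => ([], r)
  | ETok.L a :: r => ((takeBlockE r).1.cons a, (takeBlockE r).2)
  | _ :: r => takeBlockE r

theorem takeBlockE_len : ∀ l : List ETok, (takeBlockE l).2.length ≤ l.length := by
  intro l
  induction l with
  | nil => simp [takeBlockE]
  | cons t r ih => cases t <;> simp [takeBlockE] <;> omega

/-- Auxiliary function for the endpoint shuffle `A ∘ B`: traverse the `i`-th fresh
copy of `A` (relabeling by `loc i`), inserting the next left-endpoint letter of the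
list `ins` (relabeled by `glob`) at the end of each special block. -/
def ecopyIns (i : ℕ) : List ETok → List ℕ → List ETok
  | [], _ => []
  | ETok.L a :: r, ins => ETok.L (loc i a) :: ecopyIns i r ins
  | ETok.R a :: r, ins => ETok.R (loc i a) :: ecopyIns i r ins
  | ETok.op :: r, ins => ETok.op :: ecopyIns i r ins
  | ETok.cl :: r, b :: ins => ETok.L (glob b) :: ETok.cl :: ecopyIns i r ins
  | ETok.cl :: r, [] => ETok.cl :: ecopyIns i r []

/-- Auxiliary function for the endpoint shuffle: traverse `B` (relabeling by
`glob`), replacing its `i`-th special block by the `i`-th modified copy of `A`. -/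
def eshufAux (A : List ETok) : ℕ → List ETok → List ETok
  | _, [] => []
  | i, ETok.op :: r => ecopyIns i A (takeBlockE r).1 ++ eshufAux A (i + 1) (takeBlockE r).2
  | i, ETok.L a :: r => ETok.L (glob a) :: eshufAux A i r
  | i, ETok.R a :: r => ETok.R (glob a) :: eshufAux A i r
  | i, ETok.cl :: r => ETok.cl :: eshufAux A i r
termination_by _ l => l.length
decreasing_by
  · exact Nat.lt_succ_of_le (takeBlockE_len r)
  · exact Nat.lt_succ_self _
  · exact Nat.lt_succ_self _
  · exact Nat.lt_succ_self _

/-- The endpoint shuffle `A ∘ B` of two endpoint sequences with special blocks. -/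
def eshuffle (A B : List ETok) : List ETok := eshufAux A 0 B

/-- The token list is a well-formed sequence with special blocks: a concatenation
of symbols and of parenthesized blocks consisting only of symbols. -/
inductive Blocked : List Tok → Prop
  | nil : Blocked []
  | sym (a : ℕ) {l : List Tok} : Blocked l → Blocked (Tok.sym a :: l)
  | blk (b : List ℕ) {l : List Tok} :
      Blocked l → Blocked (Tok.op :: b.map Tok.sym ++ Tok.cl :: l)

/-- The special blocks of `S` contain only first occurrences of symbols, and every
symbol of `S` makes its first occurrence inside a special block. -/
def FirstOccBlocks (S : List Tok) : Prop :=
  (∀ (u b v : List Tok), S = u ++ Tok.op :: b ++ Tok.cl :: v →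
      ∀ a : ℕ, Tok.sym a ∈ b → a ∉ symsOf u ∧ (symsOf b).count a = 1) ∧
  (∀ a ∈ symsOf S, ∃ (u b v : List Tok),
      S = u ++ Tok.op :: b ++ Tok.cl :: v ∧ Tok.sym a ∈ b ∧ a ∉ symsOf u)

/-! ### Structured form of a sequence with special blocks -/

/-- A piece of a sequence with special blocks: a symbol outside of the blocks, or a block. -/
inductive Item : Type where
  | one : ℕ → Item
  | blk : List ℕ → Item

namespace Item

/-- The symbols of an item. -/
def syms : Item → List ℕ
  | one a => [a]
  | blk l => l

/-- The tokens of an item. -/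
def toks : Item → List Tok
  | one a => [Tok.sym a]
  | blk l => Tok.op :: l.map Tok.sym ++ [Tok.cl]

/-- The block contents, if the item is a block. -/
def block? : Item → Option (List ℕ)
  | one _ => none
  | blk l => some l

end Item

open Item

/-- The symbol sequence of a list of items. -/
def itemSyms (T : List Item) : List ℕ := T.flatMap Item.syms

/-- The token list of a list of items. -/
def render (T : List Item) : List Tok := T.flatMap Item.toks

/-- The special blocks of a list of items. -/
def itemBlocks (T : List Item) : List (List ℕ) := T.filterMap Item.block?

@[simp] theorem itemSyms_nil : itemSyms [] = [] := rfl

@[simp] theorem itemSyms_one (a : ℕ) (T : List Item) :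
    itemSyms (one a :: T) = a :: itemSyms T := rfl

@[simp] theorem itemSyms_blk (l : List ℕ) (T : List Item) :
    itemSyms (blk l :: T) = l ++ itemSyms T := rfl

@[simp] theorem itemSyms_append (T T' : List Item) :
    itemSyms (T ++ T') = itemSyms T ++ itemSyms T' := List.flatMap_append

@[simp] theorem itemSyms_map_one (l : List ℕ) : itemSyms (l.map one) = l := by
  induction l with
  | nil => rfl
  | cons a l ih => simp [ih]

@[simp] theorem render_nil : render [] = [] := rfl

@[simp] theorem render_one (a : ℕ) (T : List Item) :
    render (one a :: T) = Tok.sym a :: render T := rfl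

@[simp] theorem render_blk (l : List ℕ) (T : List Item) :
    render (blk l :: T) = Tok.op :: (l.map Tok.sym ++ Tok.cl :: render T) := by
  simp [render, Item.toks]

@[simp] theorem render_append (T T' : List Item) :
    render (T ++ T') = render T ++ render T' := List.flatMap_append

@[simp] theorem render_map_one (l : List ℕ) : render (l.map one) = l.map Tok.sym := by
  induction l with
  | nil => rfl
  | cons a l ih => simp [ih]

@[simp] theorem itemBlocks_nil : itemBlocks [] = [] := rfl

@[simp] theorem itemBlocks_one (a : ℕ) (T : List Item) :
    itemBlocks (one a :: T) = itemBlocks T := rfl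

@[simp] theorem itemBlocks_blk (l : List ℕ) (T : List Item) :
    itemBlocks (blk l :: T) = l :: itemBlocks T := rfl

@[simp] theorem itemBlocks_append (T T' : List Item) :
    itemBlocks (T ++ T') = itemBlocks T ++ itemBlocks T' := List.filterMap_append

@[simp] theorem itemBlocks_map_one (l : List ℕ) : itemBlocks (l.map one) = [] := by
  induction l with
  | nil => rfl
  | cons a l ih => simp [ih]

theorem exists_eq_of_mem_itemBlocks {T : List Item} {l : List ℕ} (h : l ∈ itemBlocks T) :
    ∃ U V, T = U ++ blk l :: V := by
  induction T with
  | nil => simp at h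
  | cons t T ih =>
    cases t with
    | one a =>
      obtain ⟨U, V, rfl⟩ := ih (by simpa using h)
      exact ⟨one a :: U, V, rfl⟩
    | blk l' =>
      rcases List.mem_cons.1 (by simpa using h) with rfl | h
      · exact ⟨[], T, rfl⟩
      · obtain ⟨U, V, rfl⟩ := ih h
        exact ⟨blk l' :: U, V, rfl⟩

/-! ### Token functions on rendered lists -/

theorem symsOf_map_sym_append (l : List ℕ) (r : List Tok) :
    symsOf (l.map Tok.sym ++ r) = l ++ symsOf r := by
  induction l with
  | nil => rfl
  | cons a l ih => simp [symsOf, ih]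

theorem symsOf_render (T : List Item) : symsOf (render T) = itemSyms T := by
  induction T with
  | nil => rfl
  | cons t T ih => cases t <;> simp [symsOf, symsOf_map_sym_append, ih]

theorem takeBlock_map_sym (l : List ℕ) (r : List Tok) :
    takeBlock (l.map Tok.sym ++ Tok.cl :: r) = (l, r) := by
  induction l with
  | nil => rfl
  | cons a l ih => simp [takeBlock, ih]

theorem blocksOf_render (T : List Item) : blocksOf (render T) = itemBlocks T := by
  induction T with
  | nil => simp [blocksOf]
  | cons t T ih => cases t <;> simp [blocksOf, takeBlock_map_sym, ih]

theorem numBlocks_render (T : List Item) : numBlocks (render T) = (itemBlocks T).length := by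
  unfold numBlocks
  induction T with
  | nil => rfl
  | cons t T ih =>
    cases t with
    | one a => simpa using ih
    | blk l =>
      have h : List.count Tok.op (l.map Tok.sym) = 0 := by
        simp [List.count_eq_zero]
      simp [ih, h]

/-! ### The shuffle on items -/

/-- The structured form of `copyIns`. -/
def itemCopy (i : ℕ) : List Item → List ℕ → List Item
  | [], _ => []
  | one a :: r, ins => one (loc i a) :: itemCopy i r ins
  | blk _ :: _, [] => []
  | blk l :: r, g :: ins =>
      blk (l.map (loc i) ++ [glob g]) :: one (loc i (l.getLastD 0)) :: itemCopy i r ins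

/-- The structured form of `bulletAux`. -/
def itemBullet (A : List Item) : ℕ → List Item → List Item
  | _, [] => []
  | i, one a :: r => one (glob a) :: itemBullet A i r
  | i, blk l :: r =>
      itemCopy i A l ++ one (glob (l.getLastD 0)) :: itemBullet A (i + 1) r

theorem copyIns_map_sym (i : ℕ) (l : List ℕ) (hl : l ≠ []) (r : List Tok) (ins : List ℕ)
    (p : Option ℕ) :
    copyIns i (l.map Tok.sym ++ r) ins p =
      (l.map (loc i)).map Tok.sym ++ copyIns i r ins (some (loc i (l.getLastD 0))) := by
  induction l generalizing p with
  | nil => exact absurd rfl hl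
  | cons a l ih =>
    cases l with
    | nil => simp [copyIns]
    | cons b l =>
      have := ih (by simp) (some (loc i a))
      simp only [List.map_cons, List.cons_append, copyIns] at this ⊢
      rw [this]
      rfl

theorem copyIns_render (i : ℕ) (A : List Item) (hA : ∀ l ∈ itemBlocks A, l ≠ [])
    (ins : List ℕ) (h : ins.length = (itemBlocks A).length) (p : Option ℕ) :
    copyIns i (render A) ins p = render (itemCopy i A ins) := by
  induction A generalizing ins p with
  | nil => simp [copyIns, itemCopy]
  | cons t A ih =>
    cases t with
    | one a => simp [copyIns, itemCopy, ih (by simpa using hA) ins (by simpa using h)]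
    | blk l =>
      cases ins with
      | nil => simp at h
      | cons g ins =>
        simp only [itemBlocks_blk, List.mem_cons, forall_eq_or_imp] at hA
        simp [copyIns, itemCopy, copyIns_map_sym i l hA.1,
          ih hA.2 ins (by simpa using h)]

theorem bulletAux_render (A : List Item) (hA : ∀ l ∈ itemBlocks A, l ≠ []) (i : ℕ)
    (B : List Item) (hB : ∀ l ∈ itemBlocks B, l ≠ [] ∧ l.length = (itemBlocks A).length) :
    bulletAux (render A) i (render B) = render (itemBullet A i B) := by
  induction B generalizing i with
  | nil => simp [bulletAux, itemBullet]
  | cons t B ih =>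
    cases t with
    | one a => simp [bulletAux, itemBullet, ih i (by simpa using hB)]
    | blk l =>
      simp only [itemBlocks_blk, List.mem_cons, forall_eq_or_imp] at hB
      obtain ⟨x, hx⟩ := Option.ne_none_iff_exists'.1 (mt List.getLast?_eq_none_iff.1 hB.1.1)
      simp [bulletAux, itemBullet, takeBlock_map_sym, copyA, ih (i + 1) hB.2,
        copyIns_render i A hA l hB.1.2, hx]

theorem itemCopy_append (i : ℕ) (A A' : List Item) (ins ins' : List ℕ)
    (h : ins.length = (itemBlocks A).length) :
    itemCopy i (A ++ A') (ins ++ ins') = itemCopy i A ins ++ itemCopy i A' ins' := by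
  induction A generalizing ins with
  | nil =>
    obtain rfl : ins = [] := by simpa using h
    simp [itemCopy]
  | cons t A ih =>
    cases t with
    | one a => simp [itemCopy, ih ins (by simpa using h)]
    | blk l =>
      cases ins with
      | nil => simp at h
      | cons g ins => simp [itemCopy, ih ins (by simpa using h)]

theorem itemBullet_append (A : List Item) (i : ℕ) (B B' : List Item) :
    itemBullet A i (B ++ B') =
      itemBullet A i B ++ itemBullet A (i + (itemBlocks B).length) B' := by
  induction B generalizing i with
  | nil => simp [itemBullet]
  | cons t B ih =>
    cases t with
    | one a => simp [itemBullet, ih]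
    | blk l => simp [itemBullet, ih, Nat.add_comm, Nat.add_left_comm]

theorem itemCopy_map_one (i : ℕ) (l ins : List ℕ) :
    itemCopy i (l.map one) ins = (l.map (loc i)).map one := by
  induction l with
  | nil => simp [itemCopy]
  | cons a l ih => simp [itemCopy] at ih ⊢; exact ih

theorem itemBullet_map_one (A : List Item) (i : ℕ) (l : List ℕ) :
    itemBullet A i (l.map one) = (l.map glob).map one := by
  induction l with
  | nil => simp [itemBullet]
  | cons a l ih => simp [itemBullet] at ih ⊢; exact ih

/-! ### Symbols of the shuffle -/

theorem loc_inj {i j a b : ℕ} : loc i a = loc j b ↔ i = j ∧ a = b := by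
  simp [loc, Nat.pair_eq_pair]

theorem loc_injective (i : ℕ) : Function.Injective (loc i) := fun _ _ h => (loc_inj.1 h).2

theorem glob_injective : Function.Injective glob := fun a b h => by
  unfold glob at h; omega

theorem loc_ne_glob (i a b : ℕ) : loc i a ≠ glob b := by
  unfold loc glob; omega

theorem getLastD_mem {l : List ℕ} (hl : l ≠ []) (d : ℕ) : l.getLastD d ∈ l := by
  rw [List.getLastD_eq_getLast?, List.getLast?_eq_some_getLast hl]
  exact List.getLast_mem hl

theorem mem_itemCopy {i : ℕ} {A : List Item} (hA : ∀ l ∈ itemBlocks A, l ≠ []) {ins : List ℕ}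
    {y : ℕ} (hy : y ∈ itemSyms (itemCopy i A ins)) :
    (∃ a ∈ itemSyms A, y = loc i a) ∨ ∃ g ∈ ins, y = glob g := by
  induction A generalizing ins with
  | nil => simp [itemCopy] at hy
  | cons t A ih =>
    cases t with
    | one a =>
      simp only [itemCopy, itemSyms_one, List.mem_cons] at hy
      rcases hy with rfl | hy
      · exact Or.inl ⟨a, by simp, rfl⟩
      · rcases ih (by simpa using hA) hy with ⟨b, hb, rfl⟩ | h
        · exact Or.inl ⟨b, by simp [hb], rfl⟩
        · exact Or.inr h
    | blk l =>
      simp only [itemBlocks_blk, List.mem_cons, forall_eq_or_imp] at hA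
      cases ins with
      | nil => simp [itemCopy] at hy
      | cons g ins =>
        simp only [itemCopy, itemSyms_blk, itemSyms_one, List.mem_append, List.mem_cons,
          List.mem_map, List.not_mem_nil, or_false] at hy
        rcases hy with (⟨a, ha, rfl⟩ | rfl) | rfl | hy
        · exact Or.inl ⟨a, by simp [ha], rfl⟩
        · exact Or.inr ⟨g, by simp, rfl⟩
        · exact Or.inl ⟨_, List.mem_append_left _ (getLastD_mem hA.1 0), rfl⟩
        · rcases ih hA.2 hy with ⟨b, hb, rfl⟩ | ⟨b, hb, rfl⟩
          · exact Or.inl ⟨b, by simp [hb], rfl⟩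
          · exact Or.inr ⟨b, by simp [hb], rfl⟩

theorem mem_itemBullet {A : List Item} (hA : ∀ l ∈ itemBlocks A, l ≠ []) {i : ℕ}
    {B : List Item} (hB : ∀ l ∈ itemBlocks B, l ≠ []) {y : ℕ}
    (hy : y ∈ itemSyms (itemBullet A i B)) :
    (∃ g ∈ itemSyms B, y = glob g) ∨
      ∃ U l V, B = U ++ blk l :: V ∧ ∃ a ∈ itemSyms A, y = loc (i + (itemBlocks U).length) a := by
  induction B generalizing i with
  | nil => simp [itemBullet] at hy
  | cons t B ih =>
    cases t with
    | one a =>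
      simp only [itemBullet, itemSyms_one, List.mem_cons] at hy
      rcases hy with rfl | hy
      · exact Or.inl ⟨a, by simp, rfl⟩
      · rcases ih (by simpa using hB) hy with ⟨b, hb, rfl⟩ | ⟨U, l, V, rfl, b, hb, rfl⟩
        · exact Or.inl ⟨b, by simp [hb], rfl⟩
        · exact Or.inr ⟨one a :: U, l, V, rfl, b, hb, rfl⟩
    | blk l =>
      simp only [itemBlocks_blk, List.mem_cons, forall_eq_or_imp] at hB
      simp only [itemBullet, itemSyms_append, itemSyms_one, List.mem_append, List.mem_cons] at hy
      rcases hy with hy | rfl | hy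
      · rcases mem_itemCopy hA hy with ⟨b, hb, rfl⟩ | ⟨b, hb, rfl⟩
        · exact Or.inr ⟨[], l, B, rfl, b, hb, rfl⟩
        · exact Or.inl ⟨b, by simp [hb], rfl⟩
      · exact Or.inl ⟨_, List.mem_append_left _ (getLastD_mem hB.1 0), rfl⟩
      · rcases ih hB.2 hy with ⟨b, hb, rfl⟩ | ⟨U, l', V, rfl, b, hb, rfl⟩
        · exact Or.inl ⟨b, by simp [hb], rfl⟩
        · exact Or.inr ⟨blk l :: U, l', V, rfl, b, hb,
            by simp [Nat.add_comm, Nat.add_left_comm]⟩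

theorem glob_not_mem_itemBullet {A : List Item} (hA : ∀ l ∈ itemBlocks A, l ≠ []) {i : ℕ}
    {B : List Item} (hB : ∀ l ∈ itemBlocks B, l ≠ []) {g : ℕ} (hg : g ∉ itemSyms B) :
    glob g ∉ itemSyms (itemBullet A i B) := by
  intro h
  rcases mem_itemBullet hA hB h with ⟨g', hg', e⟩ | ⟨_, _, _, _, a, _, e⟩
  · exact hg (glob_injective e ▸ hg')
  · exact loc_ne_glob _ _ _ e.symm

theorem loc_not_mem_itemBullet {A : List Item} (hA : ∀ l ∈ itemBlocks A, l ≠ []) {i : ℕ}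
    {B : List Item} (hB : ∀ l ∈ itemBlocks B, l ≠ []) {j a : ℕ}
    (hj : j < i ∨ i + (itemBlocks B).length ≤ j) :
    loc j a ∉ itemSyms (itemBullet A i B) := by
  intro h
  rcases mem_itemBullet hA hB h with ⟨g', _, e⟩ | ⟨U, l, V, rfl, b, _, e⟩
  · exact loc_ne_glob _ _ _ e
  · have := (loc_inj.1 e).1
    simp at hj
    omega

theorem map_loc_sublist_itemCopy (i : ℕ) (A : List Item) (ins : List ℕ)
    (h : ins.length = (itemBlocks A).length) :
    ((itemSyms A).map (loc i)).Sublist (itemSyms (itemCopy i A ins)) := by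
  induction A generalizing ins with
  | nil => simp
  | cons t A ih =>
    cases t with
    | one a => simpa [itemCopy] using ih ins (by simpa using h)
    | blk l =>
      cases ins with
      | nil => simp at h
      | cons g ins =>
        simp only [itemCopy, itemSyms_blk, itemSyms_one, List.map_append]
        exact (List.sublist_append_left _ _).append ((ih ins (by simpa using h)).cons _)

theorem map_glob_sublist_itemCopy (i : ℕ) (A : List Item) (ins : List ℕ)
    (h : ins.length = (itemBlocks A).length) :
    (ins.map glob).Sublist (itemSyms (itemCopy i A ins)) := by
  induction A generalizing ins with
  | nil =>
    obtain rfl : ins = [] := by simpa using h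
    simp
  | cons t A ih =>
    cases t with
    | one a => simpa [itemCopy] using (ih ins (by simpa using h)).cons _
    | blk l =>
      cases ins with
      | nil => simp at h
      | cons g ins =>
        simp only [itemCopy, itemSyms_blk, itemSyms_one, List.map_cons]
        exact (List.sublist_append_right _ [glob g]).append
          ((ih ins (by simpa using h)).cons _)

theorem map_glob_sublist_itemBullet (A : List Item) (i : ℕ) (B : List Item)
    (hB : ∀ l ∈ itemBlocks B, l.length = (itemBlocks A).length) :
    ((itemSyms B).map glob).Sublist (itemSyms (itemBullet A i B)) := by
  induction B generalizing i with
  | nil => simp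
  | cons t B ih =>
    cases t with
    | one a => simpa [itemBullet] using ih i (by simpa using hB)
    | blk l =>
      simp only [itemBlocks_blk, List.mem_cons, forall_eq_or_imp] at hB
      simp only [itemBullet, itemSyms_blk, itemSyms_append, itemSyms_one, List.map_append]
      exact (map_glob_sublist_itemCopy i A l hB.1).append ((ih (i + 1) hB.2).cons _)

/-! ### Blocks of the shuffle -/

theorem itemCopy_eq_append_blk {i : ℕ} {A : List Item} {ins : List ℕ} {U V : List Item}
    {l : List ℕ} (hlen : ins.length = (itemBlocks A).length)
    (h : itemCopy i A ins = U ++ blk l :: V) :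
    ∃ U' l' V' ins₁ g ins₂, A = U' ++ blk l' :: V' ∧ ins = ins₁ ++ g :: ins₂ ∧
      ins₁.length = (itemBlocks U').length ∧ ins₂.length = (itemBlocks V').length ∧
      U = itemCopy i U' ins₁ ∧ l = l'.map (loc i) ++ [glob g] ∧
      V = one (loc i (l'.getLastD 0)) :: itemCopy i V' ins₂ := by
  induction A generalizing ins U with
  | nil => simp [itemCopy] at h
  | cons t A ih =>
    cases t with
    | one a =>
      cases U with
      | nil => simp [itemCopy] at h
      | cons u U =>
        simp only [itemCopy, List.cons_append, List.cons.injEq] at h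
        obtain ⟨rfl, h⟩ := h
        obtain ⟨U', l', V', ins₁, g, ins₂, rfl, rfl, h₁, h₂, rfl, rfl, rfl⟩ :=
          ih (by simpa using hlen) h
        exact ⟨one a :: U', l', V', ins₁, g, ins₂, rfl, rfl, h₁, h₂, rfl, rfl, rfl⟩
    | blk l₀ =>
      cases ins with
      | nil => simp at hlen
      | cons g₀ ins =>
        cases U with
        | nil =>
          simp only [itemCopy, List.nil_append, List.cons.injEq, blk.injEq] at h
          obtain ⟨rfl, rfl⟩ := h
          exact ⟨[], l₀, A, [], g₀, ins, rfl, rfl, rfl, by simpa using hlen, rfl, rfl, rfl⟩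
        | cons u U =>
          cases U with
          | nil => simp [itemCopy] at h
          | cons u' U =>
            simp only [itemCopy, List.cons_append, List.cons.injEq] at h
            obtain ⟨rfl, rfl, h⟩ := h
            obtain ⟨U', l', V', ins₁, g, ins₂, rfl, rfl, h₁, h₂, rfl, rfl, rfl⟩ :=
              ih (by simpa using hlen) h
            exact ⟨blk l₀ :: U', l', V', g₀ :: ins₁, g, ins₂, rfl, rfl, by simp [h₁], h₂,
              rfl, rfl, rfl⟩

theorem itemBullet_eq_append_blk {A : List Item} {i : ℕ} {B : List Item} {U V : List Item}
    {l : List ℕ} (h : itemBullet A i B = U ++ blk l :: V) :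
    ∃ U' l' V' U₁ V₁, B = U' ++ blk l' :: V' ∧
      itemCopy (i + (itemBlocks U').length) A l' = U₁ ++ blk l :: V₁ ∧
      U = itemBullet A i U' ++ U₁ ∧
      V = V₁ ++ one (glob (l'.getLastD 0)) ::
        itemBullet A (i + (itemBlocks U').length + 1) V' := by
  induction B generalizing i U with
  | nil => simp [itemBullet] at h
  | cons t B ih =>
    cases t with
    | one a =>
      cases U with
      | nil => simp [itemBullet] at h
      | cons u U =>
        simp only [itemBullet, List.cons_append, List.cons.injEq] at h
        obtain ⟨rfl, h⟩ := h
        obtain ⟨U', l', V', U₁, V₁, rfl, hc, rfl, rfl⟩ := ih h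
        exact ⟨one a :: U', l', V', U₁, V₁, rfl, hc, rfl, rfl⟩
    | blk l₀ =>
      simp only [itemBullet] at h
      rcases List.append_eq_append_iff.1 h with ⟨W, rfl, hW⟩ | ⟨W, hW, hV⟩
      · cases W with
        | nil => simp at hW
        | cons w W =>
          simp only [List.cons_append, List.cons.injEq] at hW
          obtain ⟨rfl, hW⟩ := hW
          obtain ⟨U', l', V', U₁, V₁, rfl, hc, rfl, rfl⟩ := ih hW
          have e : i + 1 + (itemBlocks U').length =
            i + (itemBlocks (blk l₀ :: U')).length := by
            simp [Nat.add_comm, Nat.add_left_comm]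
          rw [e] at hc ⊢
          exact ⟨blk l₀ :: U', l', V', U₁, V₁, rfl, hc, by simp [itemBullet], rfl⟩
      · cases W with
        | nil => simp at hV
        | cons w W =>
          simp only [List.cons_append, List.cons.injEq] at hV
          obtain ⟨rfl, rfl⟩ := hV
          exact ⟨[], l₀, B, U, W, rfl, hW, rfl, rfl⟩

/-! ### The invariant -/

/-- A list of items is *leading* if every block consists of distinct symbols that do not occur
earlier, and any two adjacent symbols of a block recur in the same order after the block. -/
def Leading (T : List Item) : Prop :=
  ∀ U l V, T = U ++ blk l :: V → l.Nodup ∧ (∀ a ∈ l, a ∉ itemSyms U) ∧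
    ∀ p x y q, l = p ++ x :: y :: q → [x, y].Sublist (itemSyms V)

/-- The last occurrence of `a` is immediately followed by a symbol `b` outside of the blocks,
after an earlier subsequence `a b`. -/
def Trailing (T : List Item) (a : ℕ) : Prop :=
  ∃ U b V, T = U ++ one a :: one b :: V ∧ a ∉ itemSyms V ∧ b ≠ a ∧
    [a, b].Sublist (itemSyms U)

/-- The list ends in the symbol `a`, which occurs no later than in the last block. -/
def EndsIn (T : List Item) (a : ℕ) : Prop :=
  ∃ U l x V W, T = U ++ blk (l ++ [x]) :: V.map one ∧ x :: V = W ++ [a] ∧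
    a ∈ itemSyms U ++ (l ++ [x])

/-- The properties of `S_k(m)` carried through the recursion. -/
structure Good (m : ℕ) (T : List Item) : Prop where
  length_eq : ∀ l ∈ itemBlocks T, l.length = m
  leading : Leading T
  trailing : ∃ a, EndsIn T a ∧ ∀ y ∈ itemSyms T, y ≠ a → Trailing T y

theorem Good.ne_nil {m : ℕ} {T : List Item} (h : Good m T) (hm : m ≠ 0) :
    ∀ l ∈ itemBlocks T, l ≠ [] := by
  rintro l hl rfl
  exact hm (h.length_eq _ hl).symm

theorem EndsIn.getLast? {T : List Item} {a : ℕ} (h : EndsIn T a) :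
    (itemSyms T).getLast? = some a := by
  obtain ⟨U, l, x, V, W, rfl, e, -⟩ := h
  have : itemSyms (U ++ blk (l ++ [x]) :: V.map one) = (itemSyms U ++ l) ++ (x :: V) := by
    simp
  rw [this, e]
  simp

theorem EndsIn.itemBlocks_ne_nil {T : List Item} {a : ℕ} (h : EndsIn T a) :
    itemBlocks T ≠ [] := by
  obtain ⟨U, l, x, V, W, rfl, -⟩ := h
  simp

/-! ### The shuffle preserves the invariant -/

section Bullet

variable {m : ℕ} {A B : List Item}

theorem Leading.itemBullet (hA : Leading A) (hB : Leading B)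
    (hA0 : ∀ l ∈ itemBlocks A, l ≠ []) (hB0 : ∀ l ∈ itemBlocks B, l ≠ [])
    (hlen : ∀ l ∈ itemBlocks B, l.length = (itemBlocks A).length) :
    Leading (itemBullet A 0 B) := by
  intro U l V h
  obtain ⟨UB, lB, VB, U₁, V₁, rfl, hc, rfl, rfl⟩ := itemBullet_eq_append_blk h
  obtain ⟨hndB, hdisB, hadjB⟩ := hB UB lB VB rfl
  obtain ⟨UA, lA, VA, ins₁, g, ins₂, rfl, rfl, h₁, h₂, rfl, rfl, rfl⟩ :=
    itemCopy_eq_append_blk (hlen lB (by simp)) hc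
  obtain ⟨hndA, hdisA, hadjA⟩ := hA UA lA VA rfl
  have hlA : lA ≠ [] := hA0 lA (by simp)
  have hUA : ∀ l ∈ itemBlocks UA, l ≠ [] := fun l hl => hA0 l (by simp [hl])
  have hUB : ∀ l ∈ itemBlocks UB, l ≠ [] := fun l hl => hB0 l (by simp [hl])
  set j := 0 + (itemBlocks UB).length with hj
  refine ⟨?_, ?_, ?_⟩
  · refine List.Nodup.append (hndA.map (loc_injective j)) (List.nodup_singleton _) ?_
    simp only [List.disjoint_singleton, List.mem_map, not_exists, not_and]
    exact fun a _ => loc_ne_glob j a g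
  · intro y hy
    rw [itemSyms_append, List.mem_append, not_or]
    simp only [List.mem_append, List.mem_map, List.mem_singleton] at hy
    rcases hy with ⟨a, ha, rfl⟩ | rfl
    · refine ⟨loc_not_mem_itemBullet hA0 hUB (Or.inr hj.ge), fun hy => ?_⟩
      rcases mem_itemCopy hUA hy with ⟨b, hb, e⟩ | ⟨b, _, e⟩
      · exact hdisA a ha ((loc_inj.1 e).2 ▸ hb)
      · exact loc_ne_glob _ _ _ e
    · refine ⟨glob_not_mem_itemBullet hA0 hUB (hdisB g (by simp)), fun hy => ?_⟩
      rcases mem_itemCopy hUA hy with ⟨b, _, e⟩ | ⟨b, hb, e⟩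
      · exact loc_ne_glob _ _ _ e.symm
      · obtain rfl := glob_injective e
        exact (List.disjoint_of_nodup_append hndB) hb (by simp)
  · intro p x y q e
    rcases List.eq_nil_or_concat q with rfl | ⟨q, z, rfl⟩
    · have e' : lA.map (loc j) ++ [glob g] = (p ++ [x]) ++ [y] := by simpa using e
      obtain ⟨e₁, e₂⟩ := List.append_inj' e' rfl
      obtain rfl : glob g = y := by simpa using e₂
      have hx : loc j (lA.getLastD 0) = x := by
        obtain ⟨lA', a, rfl⟩ := (List.eq_nil_or_concat lA).resolve_left hlA
        simp at e₁ ⊢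
        exact e₁.2
      have hg : glob g ∈ glob ((ins₁ ++ g :: ins₂).getLastD 0) ::
          itemSyms (_root_.itemBullet (UA ++ blk lA :: VA) (j + 1) VB) := by
        cases ins₂ with
        | nil => simp
        | cons g' ins₂ =>
          refine List.mem_cons_of_mem _ ((map_glob_sublist_itemBullet _ (j + 1) VB
            fun l hl => hlen l (by simp [hl])).subset (List.mem_map_of_mem ?_))
          exact (hadjB ins₁ g g' ins₂ rfl).subset (by simp)
      rw [← hx]
      simp only [List.cons_append, itemSyms_one, itemSyms_append]
      exact List.Sublist.cons_cons _
        (List.singleton_sublist.2 (List.mem_append_right _ hg))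
    · have e' : lA.map (loc j) ++ [glob g] = (p ++ x :: y :: q) ++ [z] := by simpa using e
      obtain ⟨e₁, -⟩ := List.append_inj' e' rfl
      obtain ⟨p', r, rfl, rfl, e₂⟩ := List.map_eq_append_iff.1 e₁
      obtain ⟨x', r, rfl, rfl, e₃⟩ := List.map_eq_cons_iff.1 e₂
      obtain ⟨y', r, rfl, rfl, rfl⟩ := List.map_eq_cons_iff.1 e₃
      have := ((hadjA p' x' y' r rfl).map (loc j)).trans (map_loc_sublist_itemCopy j VA ins₂ h₂)
      simp only [List.cons_append, itemSyms_one, itemSyms_append]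
      exact (this.trans (List.sublist_append_left _ _)).cons _

theorem length_eq_of_mem_itemBlocks_itemBullet (hA : ∀ l ∈ itemBlocks A, l.length = m)
    (hlen : ∀ l ∈ itemBlocks B, l.length = (itemBlocks A).length) :
    ∀ l ∈ itemBlocks (itemBullet A 0 B), l.length = m + 1 := by
  intro l hl
  obtain ⟨U, V, h⟩ := exists_eq_of_mem_itemBlocks hl
  obtain ⟨UB, lB, VB, U₁, V₁, rfl, hc, rfl, rfl⟩ := itemBullet_eq_append_blk h
  obtain ⟨UA, lA, VA, ins₁, g, ins₂, rfl, rfl, -, -, -, rfl, -⟩ :=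
    itemCopy_eq_append_blk (hlen lB (by simp)) hc
  simp [hA lA (by simp)]

/-- The copy of a list ending in `a` ends in `a`, outside of the blocks, and all insertions
happen in a prefix that contains `a` before the last insertion. -/
theorem EndsIn.itemCopy {a : ℕ} (h : EndsIn A a) (i : ℕ) (ins : List ℕ)
    (hlen : ins.length = (itemBlocks A).length) :
    ∃ U l x V W, itemCopy i A ins =
        U ++ blk (l ++ [glob (ins.getLastD 0)]) :: (x :: V).map one ∧
      x :: V = W ++ [loc i a] ∧ loc i a ∈ itemSyms U ++ l ∧
      (ins.map glob).Sublist (itemSyms U ++ (l ++ [glob (ins.getLastD 0)])) := by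
  obtain ⟨U, l, x, V, W, rfl, e, ha⟩ := h
  obtain ⟨ins, g, rfl⟩ := (List.eq_nil_or_concat ins).resolve_left (by rintro rfl; simp at hlen)
  simp only [List.concat_eq_append] at hlen ⊢
  have h₁ : ins.length = (itemBlocks U).length := by simpa using hlen
  refine ⟨_root_.itemCopy i U ins, (l ++ [x]).map (loc i), loc i x, V.map (loc i),
    W.map (loc i), ?_, ?_, ?_, ?_⟩
  · rw [itemCopy_append i _ _ _ _ h₁]
    have := itemCopy_map_one i V []
    simp [_root_.itemCopy] at this ⊢
    exact this
  · simpa using congrArg (List.map (loc i)) e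
  · rcases List.mem_append.1 ha with ha | ha
    · exact List.mem_append_left _
        ((map_loc_sublist_itemCopy i U ins h₁).subset (List.mem_map_of_mem ha))
    · exact List.mem_append_right _ (List.mem_map_of_mem ha)
  · simpa using (map_glob_sublist_itemCopy i U ins h₁).append
      (List.sublist_append_right ((l ++ [x]).map (loc i)) [glob g])

theorem EndsIn.itemBullet {a b : ℕ} (hA : EndsIn A a) (hB : EndsIn B b)
    (hlen : ∀ l ∈ itemBlocks B, l.length = (itemBlocks A).length) :
    EndsIn (itemBullet A 0 B) (glob b) := by
  obtain ⟨U, l, x, V, W, rfl, e, hb⟩ := hB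
  obtain ⟨U', l', x', V', W', hc, -, -, hs⟩ :=
    hA.itemCopy (0 + (itemBlocks U).length) (l ++ [x]) (hlen _ (by simp))
  refine ⟨_root_.itemBullet A 0 U ++ U', l', glob x, x' :: V' ++ glob x :: V.map glob,
    glob x :: x' :: V' ++ W.map glob, ?_, ?_, ?_⟩
  · rw [itemBullet_append, _root_.itemBullet, hc, itemBullet_map_one]
    simp
  · have := congrArg (List.map glob) e
    simp only [List.map_cons, List.map_append] at this
    simp [this]
  · rw [itemSyms_append, List.append_assoc]
    rcases List.mem_append.1 hb with hb | hb
    · exact List.mem_append_left _ ((map_glob_sublist_itemBullet A 0 U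
        fun l hl => hlen l (by simp [hl])).subset (List.mem_map_of_mem hb))
    · have := hs.subset (List.mem_map_of_mem hb)
      simp only [List.getLastD_concat] at this
      exact List.mem_append_right _ this

theorem Trailing.itemBullet_glob {g : ℕ} (h : Trailing B g)
    (hA0 : ∀ l ∈ itemBlocks A, l ≠ []) (hB0 : ∀ l ∈ itemBlocks B, l ≠ [])
    (hlen : ∀ l ∈ itemBlocks B, l.length = (itemBlocks A).length) :
    Trailing (itemBullet A 0 B) (glob g) := by
  obtain ⟨U, b, V, rfl, hV, hne, hs⟩ := h
  refine ⟨itemBullet A 0 U, glob b, itemBullet A (0 + (itemBlocks U).length) V, ?_, ?_, ?_, ?_⟩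
  · simp [itemBullet_append, itemBullet]
  · exact glob_not_mem_itemBullet hA0 (fun l hl => hB0 l (by simp [hl])) hV
  · exact glob_injective.ne hne
  · exact (hs.map glob).trans
      (map_glob_sublist_itemBullet A 0 U fun l hl => hlen l (by simp [hl]))

theorem Trailing.itemBullet_loc {a : ℕ} (h : Trailing A a) {U V : List Item} {l : List ℕ}
    (hA0 : ∀ l ∈ itemBlocks A, l ≠ [])
    (hB0 : ∀ l' ∈ itemBlocks (U ++ blk l :: V), l' ≠ [])
    (hlen : l.length = (itemBlocks A).length) :
    Trailing (itemBullet A 0 (U ++ blk l :: V)) (loc (0 + (itemBlocks U).length) a) := by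
  set i := 0 + (itemBlocks U).length with hi
  obtain ⟨UA, b, VA, rfl, hV, hne, hs⟩ := h
  obtain ⟨ins₁, ins₂, rfl, h₁⟩ : ∃ ins₁ ins₂, l = ins₁ ++ ins₂ ∧
      ins₁.length = (itemBlocks UA).length :=
    ⟨l.take (itemBlocks UA).length, l.drop (itemBlocks UA).length, by simp, by simp [hlen]⟩
  have hVA : ∀ l ∈ itemBlocks VA, l ≠ [] := fun l hl => hA0 l (by simp [hl])
  refine ⟨itemBullet (UA ++ one a :: one b :: VA) 0 U ++ itemCopy i UA ins₁, loc i b,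
    itemCopy i VA ins₂ ++ one (glob ((ins₁ ++ ins₂).getLastD 0)) ::
      itemBullet (UA ++ one a :: one b :: VA) (i + 1) V, ?_, ?_, ?_, ?_⟩
  · rw [itemBullet_append, itemBullet, ← hi, itemCopy_append i _ _ _ _ h₁]
    simp [itemCopy]
  · simp only [itemSyms_append, itemSyms_one, List.mem_append, List.mem_cons, not_or]
    refine ⟨fun hy => ?_, loc_ne_glob _ _ _,
      loc_not_mem_itemBullet hA0 (fun l hl => hB0 l (by simp [hl])) (Or.inl (by omega))⟩
    rcases mem_itemCopy hVA hy with ⟨c, hc, e⟩ | ⟨c, _, e⟩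
    · exact hV ((loc_inj.1 e).2 ▸ hc)
    · exact loc_ne_glob _ _ _ e
  · exact (loc_injective i).ne hne
  · rw [itemSyms_append]
    exact ((hs.map (loc i)).trans (map_loc_sublist_itemCopy i UA ins₁ h₁)).trans
      (List.sublist_append_right _ _)

theorem EndsIn.trailing_itemBullet {a : ℕ} (h : EndsIn A a) {U V : List Item} {l : List ℕ}
    (hA0 : ∀ l ∈ itemBlocks A, l ≠ [])
    (hB0 : ∀ l' ∈ itemBlocks (U ++ blk l :: V), l' ≠ [])
    (hlen : l.length = (itemBlocks A).length) :
    Trailing (_root_.itemBullet A 0 (U ++ blk l :: V)) (loc (0 + (itemBlocks U).length) a) := by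
  set i := 0 + (itemBlocks U).length with hi
  obtain ⟨U', l', x, W', W, hc, e, ha, -⟩ := h.itemCopy i l hlen
  refine ⟨_root_.itemBullet A 0 U ++ U' ++ blk (l' ++ [glob (l.getLastD 0)]) :: W.map one,
    glob (l.getLastD 0), _root_.itemBullet A (i + 1) V, ?_, ?_, (loc_ne_glob _ _ _).symm, ?_⟩
  · rw [itemBullet_append, _root_.itemBullet, ← hi, hc, e]
    simp
  · exact loc_not_mem_itemBullet hA0 (fun l hl => hB0 l (by simp [hl])) (Or.inl (by omega))
  · have : [loc i a, glob (l.getLastD 0)].Sublist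
        ((itemSyms U' ++ l') ++ [glob (l.getLastD 0)]) :=
      (List.singleton_sublist.2 ha).append (List.Sublist.refl [glob (l.getLastD 0)])
    simp only [itemSyms_append, itemSyms_blk, List.append_assoc] at this ⊢
    refine List.Sublist.trans ?_ (List.sublist_append_right _ _)
    refine this.trans ?_
    simp only [← List.append_assoc]
    exact List.sublist_append_left _ _

theorem Good.itemBullet (hm : m ≠ 0) (hA : Good m A) (hB : Good (itemBlocks A).length B) :
    Good (m + 1) (itemBullet A 0 B) := by
  obtain ⟨a, ha, htA⟩ := hA.trailing
  obtain ⟨b, hb, htB⟩ := hB.trailing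
  have hA0 := hA.ne_nil hm
  have hB0 := hB.ne_nil (mt List.length_eq_zero_iff.1 ha.itemBlocks_ne_nil)
  have hlen := hB.length_eq
  refine ⟨length_eq_of_mem_itemBlocks_itemBullet hA.length_eq hlen,
    hA.leading.itemBullet hB.leading hA0 hB0 hlen, glob b, ha.itemBullet hb hlen, ?_⟩
  intro y hy hne
  rcases mem_itemBullet hA0 hB0 hy with ⟨g, hg, rfl⟩ | ⟨U, l, V, rfl, c, hc, rfl⟩
  · exact (htB g hg fun e => hne (congrArg glob e)).itemBullet_glob hA0 hB0 hlen
  · by_cases hca : c = a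
    · exact hca ▸ ha.trailing_itemBullet hA0 hB0 (hlen l (by simp))
    · exact (htA c hc hca).itemBullet_loc hA0 hB0 (hlen l (by simp))

end Bullet

/-! ### Splitting blocks of length two -/

/-- The structured form of `split2`. -/
def itemSplit : List Item → List Item
  | [] => []
  | one a :: r => one a :: itemSplit r
  | blk l :: r => l.map (fun a => blk [a]) ++ itemSplit r

theorem split2_render (T : List Item) (hT : ∀ l ∈ itemBlocks T, l.length = 2) :
    split2 (render T) = render (itemSplit T) := by
  induction T with
  | nil => simp [split2, itemSplit]
  | cons t T ih =>
    cases t with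
    | one a => simp [split2, itemSplit, ih (by simpa using hT)]
    | blk l =>
      simp only [itemBlocks_blk, List.mem_cons, forall_eq_or_imp] at hT
      obtain ⟨x, y, rfl⟩ := List.length_eq_two.1 hT.1
      simp [split2, itemSplit, ih hT.2]

theorem itemSplit_append (T T' : List Item) :
    itemSplit (T ++ T') = itemSplit T ++ itemSplit T' := by
  induction T with
  | nil => rfl
  | cons t T ih => cases t <;> simp [itemSplit, ih]

theorem itemSplit_map_one (l : List ℕ) : itemSplit (l.map one) = l.map one := by
  induction l with
  | nil => rfl
  | cons a l ih => simp [itemSplit, ih]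

theorem itemSyms_map_blk_singleton (l : List ℕ) :
    itemSyms (l.map fun a => blk [a]) = l := by
  induction l with
  | nil => rfl
  | cons a l ih => simp [ih]

theorem itemSyms_itemSplit (T : List Item) : itemSyms (itemSplit T) = itemSyms T := by
  induction T with
  | nil => rfl
  | cons t T ih => cases t <;> simp [itemSplit, itemSyms_map_blk_singleton, ih]

theorem itemSplit_eq_append_blk {T U V : List Item} {l : List ℕ}
    (h : itemSplit T = U ++ blk l :: V) :
    ∃ U' p a q V', T = U' ++ blk (p ++ a :: q) :: V' ∧ l = [a] ∧
      itemSyms U = itemSyms U' ++ p := by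
  induction T generalizing U with
  | nil => simp [itemSplit] at h
  | cons t T ih =>
    cases t with
    | one b =>
      cases U with
      | nil => simp [itemSplit] at h
      | cons u U =>
        simp only [itemSplit, List.cons_append, List.cons.injEq] at h
        obtain ⟨rfl, h⟩ := h
        obtain ⟨U', p, a, q, V', rfl, rfl, e⟩ := ih h
        exact ⟨one b :: U', p, a, q, V', rfl, rfl, by simp [e]⟩
    | blk l₀ =>
      simp only [itemSplit] at h
      have key : ∀ W, itemSplit T = W ++ blk l :: V → U = l₀.map (fun a => blk [a]) ++ W →
          ∃ U' p a q V', blk l₀ :: T = U' ++ blk (p ++ a :: q) :: V' ∧ l = [a] ∧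
            itemSyms U = itemSyms U' ++ p := by
        rintro W hW rfl
        obtain ⟨U', p, a, q, V', rfl, rfl, e⟩ := ih hW
        exact ⟨blk l₀ :: U', p, a, q, V', rfl, rfl, by simp [itemSyms_map_blk_singleton, e]⟩
      rcases List.append_eq_append_iff.1 h with ⟨W, e, hW⟩ | ⟨W, e, hW⟩
      · exact key W hW e
      · cases W with
        | nil => exact key [] (by simpa using hW.symm) (by simpa using e.symm)
        | cons w W =>
          simp only [List.cons_append, List.cons.injEq] at hW
          obtain ⟨rfl, -⟩ := hW
          obtain ⟨p, r, rfl, rfl, e₂⟩ := List.map_eq_append_iff.1 e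
          obtain ⟨a, q, rfl, e₃, -⟩ := List.map_eq_cons_iff.1 e₂
          exact ⟨[], p, a, q, T, rfl, by simpa using e₃.symm,
            by simp [itemSyms_map_blk_singleton]⟩

theorem Good.itemSplit {m : ℕ} {T : List Item} (h : Good m T) : Good 1 (itemSplit T) := by
  refine ⟨fun l hl => ?_, fun U l V e => ?_, ?_⟩
  · obtain ⟨U, V, e⟩ := exists_eq_of_mem_itemBlocks hl
    obtain ⟨-, -, a, -, -, -, rfl, -⟩ := itemSplit_eq_append_blk e
    rfl
  · obtain ⟨U', p, a, q, V', rfl, rfl, hU⟩ := itemSplit_eq_append_blk e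
    obtain ⟨hnd, hdis, -⟩ := h.leading U' _ V' rfl
    refine ⟨List.nodup_singleton a, ?_, fun p x y q e => ?_⟩
    · rw [List.forall_mem_singleton, hU, List.mem_append, not_or]
      exact ⟨hdis a (by simp), fun ha => List.disjoint_of_nodup_append hnd ha (by simp)⟩
    · have := congrArg List.length e
      simp at this
      omega
  · obtain ⟨a, ⟨U, l, x, V, W, rfl, e, ha⟩, ht⟩ := h.trailing
    refine ⟨a, ⟨_root_.itemSplit U ++ l.map (fun a => blk [a]), [], x, V, W, ?_, e, ?_⟩, ?_⟩
    · simp [itemSplit_append, _root_.itemSplit, itemSplit_map_one]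
    · simpa [itemSyms_itemSplit, itemSyms_map_blk_singleton] using ha
    · intro y hy hne
      obtain ⟨U', b, V', e', hV, hb, hs⟩ := ht y (by rwa [itemSyms_itemSplit] at hy) hne
      exact ⟨_root_.itemSplit U', b, _root_.itemSplit V',
        by rw [e', itemSplit_append]; simp [_root_.itemSplit],
        by rwa [itemSyms_itemSplit], hb, by rwa [itemSyms_itemSplit]⟩

/-! ### The base sequences -/

/-- The structured form of `S1`. -/
def itemS1 (m : ℕ) : List Item :=
  blk (List.range' 1 m) ::
    ((List.range' 1 (m - 1)).reverse ++ List.range' 2 (m - 1)).map one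

theorem render_itemS1 (m : ℕ) : render (itemS1 m) = S1 m := by
  rw [itemS1, render_blk, render_map_one, S1, List.map_append, List.cons_append]

theorem range'_eq_append_cons_cons {m x : ℕ} (h₁ : 1 ≤ x) (h₂ : x < m) :
    List.range' 1 m = List.range' 1 (x - 1) ++ x :: (x + 1) :: List.range' (x + 2) (m - x - 1) := by
  obtain ⟨y, rfl⟩ := Nat.exists_eq_add_of_le' h₁
  obtain ⟨d, rfl⟩ := Nat.exists_eq_add_of_lt h₂
  have e : y + 1 + d + 1 = y + (d + 2) := by omega
  have e' : y + 1 + d + 1 - (y + 1) - 1 = d := by omega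
  rw [e', e, ← List.range'_append_1]
  simp [List.range'_succ, Nat.add_comm, Nat.add_left_comm]

theorem good_itemS1 (m : ℕ) (hm : 1 ≤ m) : Good m (itemS1 m) := by
  refine ⟨?_, fun U l V e => ?_, m, ?_, ?_⟩
  · rw [itemS1, itemBlocks_blk, itemBlocks_map_one]
    simp
  · cases U with
    | cons u U =>
      simp only [itemS1, List.cons_append, List.cons.injEq] at e
      have := congrArg itemBlocks e.2
      rw [itemBlocks_map_one] at this
      simp at this
    | nil =>
      simp only [itemS1, List.nil_append, List.cons.injEq, blk.injEq] at e
      obtain ⟨rfl, rfl⟩ := e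
      refine ⟨List.nodup_range', by simp, fun p x y q e => ?_⟩
      have hy : y = x + 1 := by
        have hx := congrArg (fun l => l[p.length]?) e
        have hy := congrArg (fun l => l[p.length + 1]?) e
        simp at hx hy
        grind
      have hx : x ∈ List.range' 1 m := by simp [e]
      have hy' : y ∈ List.range' 1 m := by simp [e]
      simp only [List.mem_range'_1] at hx hy'
      rw [itemSyms_map_one]
      refine List.Sublist.append (l₁ := [x]) (r₁ := [y]) (List.singleton_sublist.2 ?_)
        (List.singleton_sublist.2 ?_)
      · simp only [List.mem_reverse, List.mem_range'_1]; omega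
      · simp only [List.mem_range'_1]; omega
  · obtain ⟨n, rfl⟩ := Nat.exists_eq_add_of_le' hm
    refine ⟨[], List.range' 1 n, n + 1, (List.range' 1 n).reverse ++ List.range' 2 n, ?_⟩
    cases n with
    | zero => exact ⟨[], by simp [itemS1], by simp, by simp⟩
    | succ n =>
      refine ⟨(n + 2) :: ((List.range' 1 (n + 1)).reverse ++ List.range' 2 n), ?_, ?_, by simp⟩
      · rw [itemS1, List.range'_concat]
        simp [Nat.add_comm]
      · rw [List.range'_concat (s := 2)]
        simp [Nat.add_comm 2]
  · intro y hy hne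
    have hy' : 1 ≤ y ∧ y < m := by
      rw [itemS1, itemSyms_blk, itemSyms_map_one] at hy
      simp only [List.mem_append, List.mem_reverse, List.mem_range'_1] at hy
      omega
    refine ⟨blk (List.range' 1 m) ::
      ((List.range' 2 (m - 2)).reverse ++ List.range' 1 (y - 1)).map one, y + 1,
      (List.range' (y + 2) (m - y - 1)).map one, ?_, ?_, by omega, ?_⟩
    · have h : (List.range' 1 (m - 1)).reverse ++ List.range' 2 (m - 1) =
          (List.range' 2 (m - 2)).reverse ++ List.range' 1 m := by
        obtain ⟨n, rfl⟩ := Nat.exists_eq_add_of_le' (show 2 ≤ m by omega)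
        simp [List.range'_succ]
      rw [itemS1, h]
      conv_lhs => rw [range'_eq_append_cons_cons hy'.1 hy'.2]
      rw [range'_eq_append_cons_cons hy'.1 hy'.2]
      simp
    · simp only [itemSyms_map_one, List.mem_range'_1]; omega
    · rw [itemSyms_blk, range'_eq_append_cons_cons hy'.1 hy'.2]
      refine List.Sublist.trans ?_ (List.sublist_append_left _ _)
      exact (List.Sublist.append (List.Sublist.refl [y, y + 1]) (List.nil_sublist _)).trans
        (List.sublist_append_right _ _)

/-! ### The Hart–Sharir sequences -/

theorem exists_good_render (k m : ℕ) (hk : 1 ≤ k) (hm : 1 ≤ m) :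
    ∃ T, HS k m = render T ∧ Good m T := by
  induction k, hk using Nat.le_induction generalizing m with
  | base => exact ⟨itemS1 m, by rw [HS, render_itemS1], good_itemS1 m hm⟩
  | succ k hk ihk =>
    obtain ⟨k, rfl⟩ := Nat.exists_eq_add_of_le' hk
    induction m, hm using Nat.le_induction with
    | base =>
      obtain ⟨T, e, hT⟩ := ihk 2 (by omega)
      exact ⟨itemSplit T, by rw [HS, e, split2_render T hT.length_eq], hT.itemSplit⟩
    | succ m hm ihm =>
      obtain ⟨A, eA, hA⟩ := ihm
      obtain ⟨n, rfl⟩ := Nat.exists_eq_add_of_le' hm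
      obtain ⟨a, ha, -⟩ := hA.trailing
      have hpos : 0 < (itemBlocks A).length := List.length_pos_iff.2 ha.itemBlocks_ne_nil
      obtain ⟨B, eB, hB⟩ := ihk _ hpos
      refine ⟨itemBullet A 0 B, ?_, hA.itemBullet (by omega) hB⟩
      rw [HS, eA, numBlocks_render, eB, bullet, bulletAux_render A (hA.ne_nil (by omega)) 0 B
        fun l hl => ⟨hB.ne_nil hpos.ne' l hl, hB.length_eq l hl⟩]

theorem Leading.leftClamped {T : List Item} (h : Leading T) {a : ℕ}
    (ha : 2 ≤ rankOf (render T) a) : LeftClamped (symsOf (render T)) a := by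
  rw [rankOf, blocksOf_render] at ha
  rw [symsOf_render]
  cases hf : (itemBlocks T).find? (fun b => decide (a ∈ b)) with
  | none => simp [hf] at ha
  | some l =>
    simp only [hf] at ha
    obtain ⟨U, V, rfl⟩ := exists_eq_of_mem_itemBlocks (List.mem_of_find?_eq_some hf)
    have hal : a ∈ l := by simpa using List.find?_some hf
    obtain ⟨hnd, hdis, hadj⟩ := h U l V rfl
    obtain ⟨p, q, rfl, hap⟩ := List.eq_append_cons_of_mem hal
    obtain ⟨p, x, rfl⟩ := (List.eq_nil_or_concat p).resolve_left (by rintro rfl; simp at ha)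
    simp only [List.concat_eq_append, List.append_assoc, List.cons_append, List.nil_append,
      List.mem_append, List.mem_singleton, not_or] at *
    have hxa : [x, a].Sublist (p ++ x :: a :: q) :=
      (List.Sublist.append (List.Sublist.refl [x, a]) (List.nil_sublist q)).trans
        (List.sublist_append_right _ _)
    refine ⟨itemSyms U ++ p, q ++ itemSyms V, x, by simp, ?_, Ne.symm hap.2, ?_⟩
    · simpa [hap.1] using hdis a (by simp)
    · rw [itemSyms_append, itemSyms_blk]
      exact (hxa.append (hadj p x a q rfl)).trans (List.sublist_append_right _ _)

theorem Trailing.rightClamped {T : List Item} {a : ℕ} (h : Trailing T a) :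
    RightClamped (itemSyms T) a := by
  obtain ⟨U, b, V, rfl, hV, hne, hs⟩ := h
  refine ⟨itemSyms U, itemSyms V, b, by simp, hV, hne, ?_⟩
  rw [itemSyms_append, itemSyms_one, itemSyms_one]
  exact hs.append (List.Sublist.append (List.Sublist.refl [a, b]) (List.nil_sublist _))

/-- Lemma `lem_leader`: for all `k, m ≥ 1`, every symbol of the Hart–Sharir
sequence `S_k(m)` whose rank is at least 2 is left-clamped in `S_k(m)`, and every
symbol other than the very last symbol of `S_k(m)` is right-clamped in `S_k(m)`. -/
theorem lem_leader (k m : ℕ) (hk : 1 ≤ k) (hm : 1 ≤ m) :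
    ∀ a ∈ symsOf (HS k m),
      (2 ≤ rankOf (HS k m) a → LeftClamped (symsOf (HS k m)) a) ∧
      ((symsOf (HS k m)).getLast? ≠ some a → RightClamped (symsOf (HS k m)) a) := by
  obtain ⟨T, e, hT⟩ := exists_good_render k m hk hm
  rw [e]
  refine fun a ha => ⟨hT.leading.leftClamped, fun hlast => ?_⟩
  rw [symsOf_render] at ha hlast ⊢
  obtain ⟨b, hb, ht⟩ := hT.trailing
  exact (ht a ha fun hab => hlast (hab ▸ hb.getLast?)).rightClamped
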